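/- For every tabloid T and every standard skew tableau S of the same (shifted or unshifted) skew shape, the result MJ_S(T) of modified jeu de taquin in T with respect to S is a standard skew tableau (i.e., it has increasing rows and columns). -/

import Mathlib

open scoped Classical

/-- A (possibly shifted) skew Ferrers shape `μ/λ`, given by two partitions
`μ ⊇ λ` (with distinct parts in the shifted case). -/
structure SkewShape where
  shifted : Bool
  mu : ℕ → ℕ
  lam : ℕ → ℕ
  mu_anti : ∀ i, mu (i + 1) ≤ mu i
  lam_anti : ∀ i, lam (i + 1) ≤ lam i
  lam_le_mu : ∀ i, lam i ≤ mu i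
  mu_fin : ∃ r, ∀ i, r ≤ i → mu i = 0
  mu_strict : shifted = true → ∀ i, mu (i + 1) ≠ 0 → mu (i + 1) < mu i
  lam_strict : shifted = true → ∀ i, lam (i + 1) ≠ 0 → lam (i + 1) < lam i

/-- The set of cells of the (shifted) skew Ferrers diagram (rows and columns
are 0-indexed; in the shifted case row `i` is indented by `i` cells). -/
def SkewShape.cells (sh : SkewShape) : Set (ℕ × ℕ) :=
  {c | if sh.shifted = true then
         c.1 + sh.lam c.1 ≤ c.2 ∧ c.2 < c.1 + sh.mu c.1
       else sh.lam c.1 ≤ c.2 ∧ c.2 < sh.mu c.1}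

/-- A tabloid of shape `D`: a bijective filling of the cells of `D` with the
integers `1,…,n` where `n = |D|` (normalized to be `0` outside `D`). -/
def IsTabloid (D : Set (ℕ × ℕ)) (f : ℕ × ℕ → ℕ) : Prop :=
  Set.BijOn f D (Set.Icc 1 D.ncard) ∧ ∀ c, c ∉ D → f c = 0

/-- A standard (skew) tableau: a tabloid with increasing rows and columns. -/
def IsStandard (D : Set (ℕ × ℕ)) (f : ℕ × ℕ → ℕ) : Prop :=
  IsTabloid D f ∧ ∀ c ∈ D,
    ((c.1, c.2 + 1) ∈ D → f c < f (c.1, c.2 + 1)) ∧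
    ((c.1 + 1, c.2) ∈ D → f c < f (c.1 + 1, c.2))

/-- Exchange the entries of two cells. -/
def swapCells (f : ℕ × ℕ → ℕ) (a b : ℕ × ℕ) : ℕ × ℕ → ℕ :=
  Function.update (Function.update f a (f b)) b (f a)

/-- The value of a cell, `⊤` ("infinity") outside the shape `D`. -/
noncomputable def jval (D : Set (ℕ × ℕ)) (f : ℕ × ℕ → ℕ) (c : ℕ × ℕ) : WithTop ℕ :=
  if c ∈ D then (f c : WithTop ℕ) else ⊤

/-- One step of forward jeu de taquin: the cell whose entry the moving entry at
`c` is exchanged with (the smaller of the right and lower neighbours, cells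
outside the shape counting as `∞`), provided the moving entry is not yet
stable; `none` if it is stable. -/
noncomputable def fjTarget (D : Set (ℕ × ℕ)) (f : ℕ × ℕ → ℕ) (c : ℕ × ℕ) :
    Option (ℕ × ℕ) :=
  let r := (c.1, c.2 + 1)
  let d := (c.1 + 1, c.2)
  if min (jval D f r) (jval D f d) < jval D f c then
    some (if jval D f r ≤ jval D f d then r else d)
  else none

/-- Iterated forward jeu de taquin on a pair of fillings, starting at cell `c`:
the moves are driven by the first filling and the exchanges are performed
simultaneously in both fillings. -/
noncomputable def fjIter (D : Set (ℕ × ℕ)) :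
    ℕ → ((ℕ × ℕ → ℕ) × (ℕ × ℕ → ℕ)) → ℕ × ℕ →
      ((ℕ × ℕ → ℕ) × (ℕ × ℕ → ℕ)) × (ℕ × ℕ)
  | 0, p, c => (p, c)
  | fuel + 1, p, c =>
    match fjTarget D p.1 c with
    | none => (p, c)
    | some c' => fjIter D fuel (swapCells p.1 c c', swapCells p.2 c c') c'

/-- Forward jeu de taquin in a single filling, starting at cell `c`. -/
noncomputable def fjRun (D : Set (ℕ × ℕ)) (f : ℕ × ℕ → ℕ) (c : ℕ × ℕ) :
    ℕ × ℕ → ℕ :=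
  ((fjIter D D.ncard (f, f) c).1).1

/-- The cell of the shape `D` carrying the entry `v` of the filling `f`. -/
noncomputable def cellOf (D : Set (ℕ × ℕ)) (f : ℕ × ℕ → ℕ) (v : ℕ) : ℕ × ℕ :=
  Classical.epsilon fun c => c ∈ D ∧ f c = v

/-- `MJaux D S n k T`: perform forward jeu de taquin with the entries of `T`
lying in the cells labelled `n, n-1, …, n-k+1` in `S`, in this order. -/
noncomputable def MJaux (D : Set (ℕ × ℕ)) (S : ℕ × ℕ → ℕ) (n : ℕ) :
    ℕ → (ℕ × ℕ → ℕ) → ℕ × ℕ → ℕ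
  | 0, T => T
  | k + 1, T => fjRun D (MJaux D S n k T) (cellOf D S (n - k))

/-- Modified jeu de taquin `MJ_S(T)`: perform forward jeu de taquin with the
entries of `T` in decreasing order of the labels `S` assigns to their cells. -/
noncomputable def MJ (D : Set (ℕ × ℕ)) (S T : ℕ × ℕ → ℕ) : ℕ × ℕ → ℕ :=
  MJaux D S D.ncard D.ncard T

/-- `FJaux D S₀ n k (T,S)`: perform forward jeu de taquin with the entries of the
first component in the cells labelled `n, n-1, …, n-k+1` in the fixed standard
tableau `S₀` (in this order), all transpositions being performed simultaneously
in the second component. -/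
noncomputable def FJaux (D : Set (ℕ × ℕ)) (S0 : ℕ × ℕ → ℕ) (n : ℕ) :
    ℕ → ((ℕ × ℕ → ℕ) × (ℕ × ℕ → ℕ)) → (ℕ × ℕ → ℕ) × (ℕ × ℕ → ℕ)
  | 0, p => p
  | k + 1, p => (fjIter D D.ncard (FJaux D S0 n k p) (cellOf D S0 (n - k))).1

/-- `FJ(T,S) = (S',T')`, where `T' = MJ_S(T)` and `S'` is obtained from `S` by
simultaneously performing all transpositions applied to `T` during modified
jeu de taquin with respect to `S`. -/
noncomputable def FJ (D : Set (ℕ × ℕ)) (T S : ℕ × ℕ → ℕ) :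
    (ℕ × ℕ → ℕ) × (ℕ × ℕ → ℕ) :=
  Prod.swap (FJaux D S D.ncard D.ncard (T, S))

/-- One step of backward jeu de taquin inside the subshape `E`: the cell whose
entry the moving entry at `c` is exchanged with (the larger of the left and
upper neighbours inside `E`, missing neighbours counting as `0`), provided such
a neighbour exists; `none` otherwise. -/
noncomputable def bjTarget (E : Set (ℕ × ℕ)) (f : ℕ × ℕ → ℕ) (c : ℕ × ℕ) :
    Option (ℕ × ℕ) :=
  let l := (c.1, c.2 - 1)
  let u := (c.1 - 1, c.2)
  let vl : ℕ := if 0 < c.2 ∧ l ∈ E then f l else 0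
  let vu : ℕ := if 0 < c.1 ∧ u ∈ E then f u else 0
  if (0 < c.2 ∧ l ∈ E) ∨ (0 < c.1 ∧ u ∈ E) then
    some (if vu ≤ vl then l else u)
  else none

/-- Iterated backward jeu de taquin inside the subshape `E` on a pair of
fillings, starting at cell `c`: the moves are driven by the first filling and
the exchanges are performed simultaneously in both fillings. -/
noncomputable def bjIter (E : Set (ℕ × ℕ)) :
    ℕ → ((ℕ × ℕ → ℕ) × (ℕ × ℕ → ℕ)) → ℕ × ℕ →
      ((ℕ × ℕ → ℕ) × (ℕ × ℕ → ℕ)) × (ℕ × ℕ)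
  | 0, p, c => (p, c)
  | fuel + 1, p, c =>
    match bjTarget E p.1 c with
    | none => (p, c)
    | some c' => bjIter E fuel (swapCells p.1 c c', swapCells p.2 c c') c'

/-- The elementary forward step `Jⁱ` on a pair `(T,S)`: forward jeu de taquin in
`T` with the entry lying in the cell labelled `i` in `S`, the transpositions
being performed simultaneously in `S`. -/
noncomputable def Jfwd (D : Set (ℕ × ℕ)) (i : ℕ)
    (p : (ℕ × ℕ → ℕ) × (ℕ × ℕ → ℕ)) : (ℕ × ℕ → ℕ) × (ℕ × ℕ → ℕ) :=
  (fjIter D D.ncard p (cellOf D p.2 i)).1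

/-- The elementary backward step `J_i` on a pair `(S',T')`: backward jeu de
taquin in `T'`, restricted to the subshape of cells whose entries in `S'` are
`≥ i`, with the entry of `T'` lying in the cell labelled `i` in `S'`, the
transpositions being performed simultaneously in `S'`. -/
noncomputable def Jbwd (D : Set (ℕ × ℕ)) (i : ℕ)
    (p : (ℕ × ℕ → ℕ) × (ℕ × ℕ → ℕ)) : (ℕ × ℕ → ℕ) × (ℕ × ℕ → ℕ) :=
  let q := (bjIter {c | c ∈ D ∧ i ≤ p.1 c} D.ncard (p.2, p.1) (cellOf D p.1 i)).1
  (q.2, q.1)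

/-- `BJaux D k (S',T')`: for `i = 1` to `k`, perform backward jeu de taquin in
the second component, restricted to the subshape of cells whose entries in the
current first component are `≥ i`, with the entry lying in the cell labelled
`i` in the current first component, all transpositions being performed
simultaneously in the first component. -/
noncomputable def BJaux (D : Set (ℕ × ℕ)) :
    ℕ → ((ℕ × ℕ → ℕ) × (ℕ × ℕ → ℕ)) → (ℕ × ℕ → ℕ) × (ℕ × ℕ → ℕ)
  | 0, p => p
  | i + 1, p =>
    let p' := BJaux D i p
    let q := (bjIter {c | c ∈ D ∧ i + 1 ≤ p'.1 c} D.ncard (p'.2, p'.1)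
      (cellOf D p'.1 (i + 1))).1
    (q.2, q.1)

/-- `BJ(S',T') = (T,S)`. -/
noncomputable def BJ (D : Set (ℕ × ℕ)) (S' T' : ℕ × ℕ → ℕ) :
    (ℕ × ℕ → ℕ) × (ℕ × ℕ → ℕ) :=
  Prod.swap (BJaux D D.ncard (S', T'))

/-- `JfwdList D [i₁,…,iₘ] p = Jⁱ¹(Jⁱ²(… (Jⁱᵐ p) …))`. -/
noncomputable def JfwdList (D : Set (ℕ × ℕ)) :
    List ℕ → ((ℕ × ℕ → ℕ) × (ℕ × ℕ → ℕ)) → (ℕ × ℕ → ℕ) × (ℕ × ℕ → ℕ)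
  | [], p => p
  | i :: rest, p => Jfwd D i (JfwdList D rest p)

/-- `JbwdList D [i₁,…,iₘ] p = J_{i₁}(J_{i₂}(… (J_{iₘ} p) …))`. -/
noncomputable def JbwdList (D : Set (ℕ × ℕ)) :
    List ℕ → ((ℕ × ℕ → ℕ) × (ℕ × ℕ → ℕ)) → (ℕ × ℕ → ℕ) × (ℕ × ℕ → ℕ)
  | [], p => p
  | i :: rest, p => Jbwd D i (JbwdList D rest p)

/-- `π` represents a permutation of `{1,…,n}` (it is the identity elsewhere). -/
def PermOn (n : ℕ) (π : Equiv.Perm ℕ) : Prop :=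
  ∀ i, i ∉ Set.Icc 1 n → π i = i

/-- `S_π`: the tabloid obtained from `S` by replacing every entry `i` by `π i`. -/
noncomputable def permApply (D : Set (ℕ × ℕ)) (π : Equiv.Perm ℕ)
    (S : ℕ × ℕ → ℕ) : ℕ × ℕ → ℕ :=
  fun c => if c ∈ D then π (S c) else 0

/-- Forward jeu de taquin in a single filling together with the list of cells
visited by the moving entry. -/
noncomputable def fjPath (D : Set (ℕ × ℕ)) :
    ℕ → (ℕ × ℕ → ℕ) → ℕ × ℕ → (ℕ × ℕ → ℕ) × List (ℕ × ℕ)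
  | 0, f, c => (f, [c])
  | fuel + 1, f, c =>
    match fjTarget D f c with
    | none => (f, [c])
    | some c' =>
      let q := fjPath D fuel (swapCells f c c') c'
      (q.1, c :: q.2)

/-- Backward jeu de taquin inside the subshape `E` in a single filling together
with the list of cells visited by the moving entry. -/
noncomputable def bjPath (E : Set (ℕ × ℕ)) :
    ℕ → (ℕ × ℕ → ℕ) → ℕ × ℕ → (ℕ × ℕ → ℕ) × List (ℕ × ℕ)
  | 0, f, c => (f, [c])
  | fuel + 1, f, c =>
    match bjTarget E f c with
    | none => (f, [c])
    | some c' =>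
      let q := bjPath E fuel (swapCells f c c') c'
      (q.1, c :: q.2)

/-- `b` is the right or the lower neighbour of `a`. -/
def CellAdj (a b : ℕ × ℕ) : Prop := b = (a.1, a.2 + 1) ∨ b = (a.1 + 1, a.2)

theorem CellAdj.sum_eq {a b : ℕ × ℕ} (h : CellAdj a b) : b.1 + b.2 = a.1 + a.2 + 1 := by
  rcases h with rfl | rfl <;> simp <;> omega

theorem CellAdj.ne {a b : ℕ × ℕ} (h : CellAdj a b) : a ≠ b := by
  rintro rfl
  have := h.sum_eq
  omega

theorem fjTarget_none {D : Set (ℕ × ℕ)} {f : ℕ × ℕ → ℕ} {c : ℕ × ℕ} (hc : c ∈ D)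
    (h : fjTarget D f c = none) : ∀ b ∈ D, CellAdj c b → f c ≤ f b := by
  intro b hb hcb
  unfold fjTarget at h
  simp only at h
  split_ifs at h with h1
  rw [not_lt, le_min_iff] at h1
  rcases hcb with rfl | rfl
  · simpa [jval, hc, hb] using h1.1
  · simpa [jval, hc, hb] using h1.2

theorem fjTarget_some {D : Set (ℕ × ℕ)} {f : ℕ × ℕ → ℕ} {c c' : ℕ × ℕ} (hc : c ∈ D)
    (h : fjTarget D f c = some c') :
    CellAdj c c' ∧ c' ∈ D ∧ f c' < f c ∧ ∀ b ∈ D, CellAdj c b → f c' ≤ f b := by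
  have key : CellAdj c c' ∧ jval D f c' < jval D f c ∧
      ∀ b, CellAdj c b → jval D f c' ≤ jval D f b := by
    unfold fjTarget at h
    simp only at h
    split_ifs at h with h1 h2
    · cases h
      rw [min_eq_left h2] at h1
      refine ⟨Or.inl rfl, h1, ?_⟩
      rintro b (rfl | rfl)
      · exact le_rfl
      · exact h2
    · cases h
      rw [min_eq_right (not_le.1 h2).le] at h1
      refine ⟨Or.inr rfl, h1, ?_⟩
      rintro b (rfl | rfl)
      · exact (not_le.1 h2).le
      · exact le_rfl
  obtain ⟨h1, h2, h3⟩ := key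
  have hc' : c' ∈ D := by
    by_contra hn
    simp [jval, hn] at h2
  refine ⟨h1, hc', by simpa [jval, hc, hc'] using h2, fun b hb hcb => ?_⟩
  simpa [jval, hb, hc'] using h3 b hcb

theorem swapCells_eq (f : ℕ × ℕ → ℕ) (a b x : ℕ × ℕ) :
    swapCells f a b x = if x = b then f a else if x = a then f b else f x := by
  simp [swapCells, Function.update_apply]

theorem swapCells_eq_comp (f : ℕ × ℕ → ℕ) (a b : ℕ × ℕ) :
    swapCells f a b = f ∘ Equiv.swap a b := by
  funext x
  rw [swapCells_eq, Function.comp, Equiv.swap_apply_def]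
  split_ifs <;> simp_all

theorem isTabloid_swap {D : Set (ℕ × ℕ)} {f : ℕ × ℕ → ℕ} {a b : ℕ × ℕ} (hf : IsTabloid D f)
    (ha : a ∈ D) (hb : b ∈ D) : IsTabloid D (swapCells f a b) := by
  have hm : Set.MapsTo (Equiv.swap a b) D D := by
    intro x hx
    rw [Equiv.swap_apply_def]
    split_ifs <;> assumption
  refine ⟨?_, fun c hc => ?_⟩
  · rw [swapCells_eq_comp]
    refine hf.1.comp ⟨hm, (Equiv.injective _).injOn, fun x hx => ⟨Equiv.swap a b x, hm hx, ?_⟩⟩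
    simp
  · rw [swapCells_eq, if_neg, if_neg]
    · exact hf.2 c hc
    · rintro rfl; exact hc ha
    · rintro rfl; exact hc hb

theorem IsTabloid.finite {D : Set (ℕ × ℕ)} {f : ℕ × ℕ → ℕ} (hf : IsTabloid D f) : D.Finite :=
  hf.1.finite_iff_finite.2 (Set.finite_Icc _ _)

/-- The main sliding invariant: along a slide inside an upward closed set `U`, which is
ordered except at the current cell, one ends up with an ordered filling of `U`. -/
theorem fjIter_ordered {D U : Set (ℕ × ℕ)} (hUD : U ⊆ D)
    (hU : ∀ a ∈ U, ∀ b ∈ D, CellAdj a b → b ∈ U) (fuel : ℕ) :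
    ∀ (f g : ℕ × ℕ → ℕ) (c : ℕ × ℕ), IsTabloid D f → c ∈ U →
      (∀ a ∈ U, a ≠ c → ∀ b ∈ D, CellAdj a b → f a < f b) →
      (∀ a ∈ U, CellAdj a c → ∀ b ∈ D, CellAdj c b → f a < f b) →
      {x ∈ D | c.1 + c.2 < x.1 + x.2}.ncard ≤ fuel →
      IsTabloid D (fjIter D fuel (f, g) c).1.1 ∧
      ∀ a ∈ U, ∀ b ∈ D, CellAdj a b →
        (fjIter D fuel (f, g) c).1.1 a < (fjIter D fuel (f, g) c).1.1 b := by
  induction fuel with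
  | zero =>
    intro f g c hf hc h1 h2 h3
    refine ⟨hf, fun a ha b hb hab => ?_⟩
    by_cases hac : a = c
    · subst hac
      exfalso
      have hfin : {x ∈ D | a.1 + a.2 < x.1 + x.2}.Finite := hf.finite.subset (fun x hx => hx.1)
      have := (Set.ncard_eq_zero hfin).1 (Nat.le_zero.1 h3)
      have hbm : b ∈ {x ∈ D | a.1 + a.2 < x.1 + x.2} := ⟨hb, by have := hab.sum_eq; omega⟩
      rw [this] at hbm
      exact hbm
    · exact h1 a ha hac b hb hab
  | succ n ih =>
    intro f g c hf hc h1 h2 h3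
    have hcD := hUD hc
    rcases ht : fjTarget D f c with _ | c'
    · simp only [fjIter, ht]
      refine ⟨hf, fun a ha b hb hab => ?_⟩
      by_cases hac : a = c
      · subst hac
        refine lt_of_le_of_ne (fjTarget_none hcD ht b hb hab) fun he => ?_
        exact hab.ne (hf.1.injOn hcD hb he)
      · exact h1 a ha hac b hb hab
    · simp only [fjIter, ht]
      obtain ⟨hcc, hc'D, hlt, hmin⟩ := fjTarget_some hcD ht
      have hc'U := hU c hc c' hc'D hcc
      have hne := hcc.ne
      apply ih _ _ _ (isTabloid_swap hf hcD hc'D) hc'U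
      · intro a ha hac b hb hab
        rw [swapCells_eq, swapCells_eq, if_neg hac]
        by_cases hbc' : b = c'
        · subst hbc'
          rw [if_pos rfl]
          split_ifs with hac2
          · exact hlt
          · exact (h1 a ha hac2 _ hb hab).trans hlt
        · rw [if_neg hbc']
          by_cases hac2 : a = c
          · subst hac2
            rw [if_pos rfl, if_neg hab.ne.symm]
            refine lt_of_le_of_ne (hmin b hb hab) fun he => ?_
            exact hbc' (hf.1.injOn hc'D hb he).symm
          · rw [if_neg hac2]
            split_ifs with hbc
            · subst hbc
              exact h2 a ha hab c' hc'D hcc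
            · exact h1 a ha hac2 b hb hab
      · intro a ha hac b hb hcb
        have e1 := hcc.sum_eq
        have e2 := hcb.sum_eq
        have hbc : b ≠ c := by rintro rfl; omega
        have hlt2 := h1 c' hc'U hne.symm b hb hcb
        rw [swapCells_eq, swapCells_eq, if_neg hac.ne, if_neg hcb.ne.symm, if_neg hbc]
        split_ifs with hac2
        · exact hlt2
        · exact (h1 a ha hac2 c' hc'D hac).trans hlt2
      · have : {x ∈ D | c'.1 + c'.2 < x.1 + x.2}.ncard < {x ∈ D | c.1 + c.2 < x.1 + x.2}.ncard := by
          have e1 := hcc.sum_eq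
          apply Set.ncard_lt_ncard _ (hf.finite.subset (fun x hx => hx.1))
          refine ⟨fun x hx => ⟨hx.1, by have := hx.2; omega⟩, fun hsub => ?_⟩
          have := (hsub (⟨hc'D, by omega⟩ : c' ∈ {x ∈ D | c.1 + c.2 < x.1 + x.2})).2
          omega
        omega

theorem mjaux_ordered {D : Set (ℕ × ℕ)} {S T : ℕ × ℕ → ℕ} (hT : IsTabloid D T)
    (hS : IsStandard D S) (k : ℕ) (hk : k ≤ D.ncard) :
    IsTabloid D (MJaux D S D.ncard k T) ∧
    ∀ a ∈ D, D.ncard - k < S a → ∀ b ∈ D, CellAdj a b →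
      MJaux D S D.ncard k T a < MJaux D S D.ncard k T b := by
  have hinc : ∀ a ∈ D, ∀ b ∈ D, CellAdj a b → S a < S b := by
    rintro a ha b hb (rfl | rfl)
    · exact (hS.2 a ha).1 hb
    · exact (hS.2 a ha).2 hb
  induction k with
  | zero =>
    refine ⟨hT, fun a ha hlt => ?_⟩
    have := (hS.1.1.mapsTo ha).2
    omega
  | succ k ih =>
    obtain ⟨ih1, ih2⟩ := ih (by omega)
    have hex : ∃ c, c ∈ D ∧ S c = D.ncard - k :=
      hS.1.1.surjOn (⟨by omega, by omega⟩ : D.ncard - k ∈ Set.Icc 1 D.ncard)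
    have hc := Classical.epsilon_spec hex
    change cellOf D S (D.ncard - k) ∈ D ∧ S (cellOf D S (D.ncard - k)) = D.ncard - k at hc
    simp only [MJaux, fjRun]
    generalize cellOf D S (D.ncard - k) = c at hc
    obtain ⟨hcD, hSc⟩ := hc
    have main := fjIter_ordered (D := D) (U := {x ∈ D | D.ncard - (k + 1) < S x})
      (fun x hx => hx.1)
      (fun a ha b hb hab => ⟨hb, ha.2.trans (hinc a ha.1 b hb hab)⟩) D.ncard
      (MJaux D S D.ncard k T) (MJaux D S D.ncard k T) c ih1 ⟨hcD, by omega⟩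
      (by
        intro a ha hac b hb hab
        refine ih2 a ha.1 ?_ b hb hab
        have h1 := ha.2
        have h2 : S a ≠ S c := fun he => hac (hS.1.1.injOn ha.1 hcD he)
        omega)
      (by
        intro a ha hac
        have h1 := ha.2
        have h2 := hinc a ha.1 c hcD hac
        omega)
      (Set.ncard_le_ncard (fun x hx => hx.1) hT.finite)
    exact ⟨main.1, fun a ha hlt => main.2 a ⟨ha, hlt⟩⟩

/-- for every tabloid `T` and every standard skew tableau `S`
of the same (shifted or unshifted) skew shape, `MJ_S(T)` is a standard skew
tableau. -/
theorem mj_isStandard (sh : SkewShape) (T S : ℕ × ℕ → ℕ)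
    (hT : IsTabloid sh.cells T) (hS : IsStandard sh.cells S) :
    IsStandard sh.cells (MJ sh.cells S T) := by
  obtain ⟨h1, h2⟩ := mjaux_ordered hT hS sh.cells.ncard le_rfl
  refine ⟨h1, fun c hc => ?_⟩
  have hpos : sh.cells.ncard - sh.cells.ncard < S c := by
    have := (hS.1.1.mapsTo hc).1
    omega
  exact ⟨fun h => h2 c hc hpos _ h (Or.inl rfl), fun h => h2 c hc hpos _ h (Or.inr rfl)⟩
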